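/- arXiv:2604.25549 — 9 statements merged into one kernel-verified Lean document; each statement's English description precedes it below -/
import Mathlib

section
/- Coloured blocking theorem: Let k : ℕ and K = 2·k³. Let (I,κ) be a K-sparse coloured interpretation, and let ∼_K be the K-neighbourhood equivalence on the domain of I (which is an equivalence relation). Let Q be an interpretation over the same concept names Cn and role names Rn whose domain is finite with at most k elements. Then there exists a homomorphism from Q to I if and only if there exists a homomorphism from Q to the quotient interpretation I/∼_K. -/
/-- An interpretation with concept names `Cn` and role names `Rn`. -/
structure Interp (Cn Rn : Type) where
  α : Type
  A : Cn → Set α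
  r : Rn → α → α → Prop

namespace Interp

variable {Cn Rn Γ : Type}

/-- A homomorphism of interpretations. -/
def IsHom (I J : Interp Cn Rn) (h : I.α → J.α) : Prop :=
  (∀ (c : Cn) (a : I.α), a ∈ I.A c → h a ∈ J.A c) ∧
  (∀ (s : Rn) (a b : I.α), I.r s a b → J.r s (h a) (h b))

/-- Adjacency: related by some role in either direction. -/
def Adj (I : Interp Cn Rn) (x y : I.α) : Prop :=
  ∃ s, I.r s x y ∨ I.r s y x

/-- There is a walk of length `n` from `x` to `y` along adjacent elements. -/
def ChainLen (I : Interp Cn Rn) (n : ℕ) (x y : I.α) : Prop :=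
  ∃ z : Fin (n + 1) → I.α, z 0 = x ∧ z (Fin.last n) = y ∧
    ∀ i : Fin n, Adj I (z i.castSucc) (z i.succ)

/-- The distance between two elements, in `ℕ∞`. -/
noncomputable def dist (I : Interp Cn Rn) (x y : I.α) : ℕ∞ :=
  sInf ((fun n : ℕ => (n : ℕ∞)) '' {n | ChainLen I n x y})

/-- The `k`-neighbourhood of `x`. -/
def Nbhd (I : Interp Cn Rn) (k : ℕ) (x : I.α) : Set I.α :=
  {y | dist I x y ≤ (k : ℕ∞)}

/-- The induced subinterpretation on a subset of the domain. -/
abbrev restrict (I : Interp Cn Rn) (Δ : Set I.α) : Interp Cn Rn where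
  α := Δ
  A := fun c => {a | (a : I.α) ∈ I.A c}
  r := fun s a b => I.r s (a : I.α) (b : I.α)

lemma mem_nbhd_self (I : Interp Cn Rn) (k : ℕ) (x : I.α) : x ∈ Nbhd I k x := by
  have h0 : ChainLen I 0 x x := ⟨fun _ => x, rfl, rfl, fun i => i.elim0⟩
  have h1 : dist I x x ≤ ((0 : ℕ) : ℕ∞) := sInf_le ⟨0, h0, rfl⟩
  exact le_trans h1 (by exact_mod_cast Nat.zero_le k)

/-- Colour-preserving homomorphism between coloured interpretations. -/
def ColourHom (I J : Interp Cn Rn) (κ : I.α → Option Γ) (θ : J.α → Option Γ)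
    (h : I.α → J.α) : Prop :=
  IsHom I J h ∧ (∀ x, κ x = none ↔ θ (h x) = none) ∧
  (∀ x γ, κ x = some γ → θ (h x) = some γ)

/-- The `k`-neighbourhood equivalence on the domain of a coloured interpretation. -/
def NbhdEquiv (I : Interp Cn Rn) (κ : I.α → Option Γ) (k : ℕ) (x y : I.α) : Prop :=
  x = y ∨
  ((∃ γ, κ x = some γ ∧ κ y = some γ) ∧
   (∃ h : (I.restrict (Nbhd I k x)).α → (I.restrict (Nbhd I k y)).α,
      ColourHom (I.restrict (Nbhd I k x)) (I.restrict (Nbhd I k y))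
        (fun a => κ a.val) (fun a => κ a.val) h ∧
      (h ⟨x, mem_nbhd_self I k x⟩ : I.α) = y) ∧
   (∃ g : (I.restrict (Nbhd I k y)).α → (I.restrict (Nbhd I k x)).α,
      ColourHom (I.restrict (Nbhd I k y)) (I.restrict (Nbhd I k x))
        (fun a => κ a.val) (fun a => κ a.val) g ∧
      (g ⟨y, mem_nbhd_self I k y⟩ : I.α) = x))

/-- `(I, κ)` is `k`-sparse. -/
def Sparse (I : Interp Cn Rn) (κ : I.α → Option Γ) (k : ℕ) : Prop :=
  ∀ x y y' : I.α, y ∈ Nbhd I k x → y' ∈ Nbhd I k x →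
    (∃ γ, κ y = some γ) → (∃ γ', κ y' = some γ') → y ≠ y' → κ y ≠ κ y'

/-- The quotient of an interpretation by a relation on its domain. -/
def quot (I : Interp Cn Rn) (R : I.α → I.α → Prop) : Interp Cn Rn where
  α := Quot R
  A := fun c => {q | ∃ x, q = Quot.mk R x ∧ x ∈ I.A c}
  r := fun s p q => ∃ x y, p = Quot.mk R x ∧ q = Quot.mk R y ∧ I.r s x y

end Interp

namespace Interp

section Neighbourhoods

variable {Cn Rn : Type} {I : Interp Cn Rn}

lemma Adj.symm {x y : I.α} (h : Adj I x y) : Adj I y x :=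
  h.imp fun _ => Or.symm

lemma chainLen_zero_iff {x y : I.α} : ChainLen I 0 x y ↔ x = y := by
  constructor
  · rintro ⟨z, rfl, rfl, -⟩
    rfl
  · rintro rfl
    exact ⟨fun _ => x, rfl, rfl, fun i => i.elim0⟩

lemma chainLen_succ_iff {n : ℕ} {x y : I.α} :
    ChainLen I (n + 1) x y ↔ ∃ z, ChainLen I n x z ∧ Adj I z y := by
  constructor
  · rintro ⟨z, rfl, rfl, hz⟩
    refine ⟨z (Fin.last n).castSucc, ⟨fun i => z i.castSucc, rfl, rfl, fun i => ?_⟩, ?_⟩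
    · exact hz i.castSucc
    · exact hz (Fin.last n)
  · rintro ⟨_, ⟨z, rfl, rfl, hz⟩, hy⟩
    refine ⟨Fin.snoc (α := fun _ => I.α) z y, ?_, ?_, fun i => ?_⟩
    · exact Fin.snoc_castSucc (α := fun _ => I.α) y z 0
    · exact Fin.snoc_last (α := fun _ => I.α) y z
    · refine Fin.lastCases ?_ (fun i => ?_) i
      · rw [Fin.succ_last, Fin.snoc_last, Fin.snoc_castSucc]
        exact hy
      · rw [Fin.succ_castSucc, Fin.snoc_castSucc, Fin.snoc_castSucc]
        exact hz i

lemma mem_nbhd_iff {k : ℕ} {x y : I.α} : y ∈ Nbhd I k x ↔ ∃ n ≤ k, ChainLen I n x y := by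
  constructor
  · intro h
    have h' : dist I x y < ((k + 1 : ℕ) : ℕ∞) :=
      lt_of_le_of_lt h (by exact_mod_cast Nat.lt_succ_self k)
    obtain ⟨_, ⟨n, hn, rfl⟩, hlt⟩ := sInf_lt_iff.1 h'
    exact ⟨n, Nat.lt_succ_iff.1 (Nat.cast_lt.1 hlt), hn⟩
  · rintro ⟨n, hnk, hn⟩
    exact (sInf_le ⟨n, hn, rfl⟩ : dist I x y ≤ (n : ℕ∞)).trans (by exact_mod_cast hnk)

lemma nbhd_mono {m n : ℕ} (hmn : m ≤ n) {x y : I.α} (h : y ∈ Nbhd I m x) : y ∈ Nbhd I n x := by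
  obtain ⟨j, hj, hc⟩ := mem_nbhd_iff.1 h
  exact mem_nbhd_iff.2 ⟨j, hj.trans hmn, hc⟩

lemma mem_nbhd_zero {x y : I.α} : y ∈ Nbhd I 0 x ↔ x = y := by
  simp [mem_nbhd_iff, chainLen_zero_iff]

lemma Adj.mem_nbhd_succ {n : ℕ} {x y z : I.α} (h : Adj I y z) (hy : y ∈ Nbhd I n x) :
    z ∈ Nbhd I (n + 1) x := by
  obtain ⟨j, hj, hc⟩ := mem_nbhd_iff.1 hy
  exact mem_nbhd_iff.2 ⟨j + 1, by omega, chainLen_succ_iff.2 ⟨y, hc, h⟩⟩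

lemma Adj.mem_nbhd_one {x y : I.α} (h : Adj I x y) : y ∈ Nbhd I 1 x :=
  h.mem_nbhd_succ (mem_nbhd_self I 0 x)

lemma exists_of_mem_nbhd_succ {n : ℕ} {x y : I.α} (h : y ∈ Nbhd I (n + 1) x) :
    y ∈ Nbhd I n x ∨ ∃ z ∈ Nbhd I n x, Adj I z y := by
  obtain ⟨j, hj, hc⟩ := mem_nbhd_iff.1 h
  rcases Nat.lt_or_ge j (n + 1) with hlt | hge
  · exact Or.inl (mem_nbhd_iff.2 ⟨j, by omega, hc⟩)
  · obtain rfl : j = n + 1 := by omega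
    obtain ⟨z, hz, hzy⟩ := chainLen_succ_iff.1 hc
    exact Or.inr ⟨z, mem_nbhd_iff.2 ⟨n, le_rfl, hz⟩, hzy⟩

lemma nbhd_trans {m n : ℕ} {x y z : I.α} (hy : y ∈ Nbhd I m x) (hz : z ∈ Nbhd I n y) :
    z ∈ Nbhd I (m + n) x := by
  induction n generalizing z with
  | zero => rwa [← mem_nbhd_zero.1 hz]
  | succ n ih =>
    rcases exists_of_mem_nbhd_succ hz with hz | ⟨w, hw, hwz⟩
    · exact nbhd_mono (by omega) (ih hz)
    · exact hwz.mem_nbhd_succ (ih hw)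

end Neighbourhoods

section LocalHom

variable {Cn Rn Γ : Type} {I : Interp Cn Rn} {κ : I.α → Option Γ}

/-- `φ` restricts to a colour-preserving homomorphism on the `m`-neighbourhood of `x`. -/
structure LocalHom (I : Interp Cn Rn) (κ : I.α → Option Γ) (m : ℕ) (x : I.α)
    (φ : I.α → I.α) : Prop where
  colour : ∀ a ∈ Nbhd I m x, κ (φ a) = κ a
  concept : ∀ a ∈ Nbhd I m x, ∀ c, a ∈ I.A c → φ a ∈ I.A c
  role : ∀ a ∈ Nbhd I m x, ∀ b ∈ Nbhd I m x, ∀ s, I.r s a b → I.r s (φ a) (φ b)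

lemma LocalHom.adj {m : ℕ} {x : I.α} {φ : I.α → I.α} (h : LocalHom I κ m x φ) {a b : I.α}
    (ha : a ∈ Nbhd I m x) (hb : b ∈ Nbhd I m x) (hab : Adj I a b) : Adj I (φ a) (φ b) :=
  hab.imp fun s => Or.imp (h.role a ha b hb s) (h.role b hb a ha s)

lemma LocalHom.map_mem_nbhd {m n : ℕ} {x : I.α} {φ : I.α → I.α} (h : LocalHom I κ m x φ)
    (hnm : n ≤ m) {a : I.α} (ha : a ∈ Nbhd I n x) : φ a ∈ Nbhd I n (φ x) := by
  induction n generalizing a with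
  | zero => rw [mem_nbhd_zero.1 ha]; exact mem_nbhd_self I 0 _
  | succ n ih =>
    rcases exists_of_mem_nbhd_succ ha with ha' | ⟨z, hz, hza⟩
    · exact nbhd_mono n.le_succ (ih (by omega) ha')
    · exact (h.adj (nbhd_mono (by omega) hz) (nbhd_mono hnm ha) hza).mem_nbhd_succ
        (ih (by omega) hz)

lemma LocalHom.of_nbhd {m n : ℕ} {x y : I.α} {φ : I.α → I.α} (h : LocalHom I κ m x φ)
    (hsub : ∀ a ∈ Nbhd I n y, a ∈ Nbhd I m x) : LocalHom I κ n y φ :=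
  ⟨fun a ha => h.colour a (hsub a ha), fun a ha => h.concept a (hsub a ha),
    fun a ha b hb => h.role a (hsub a ha) b (hsub b hb)⟩

lemma LocalHom.comp {m : ℕ} {x : I.α} {φ ψ : I.α → I.α} (hψ : LocalHom I κ m (φ x) ψ)
    (hφ : LocalHom I κ m x φ) : LocalHom I κ m x (ψ ∘ φ) :=
  ⟨fun a ha => (hψ.colour _ (hφ.map_mem_nbhd le_rfl ha)).trans (hφ.colour a ha),
    fun a ha c hc => hψ.concept _ (hφ.map_mem_nbhd le_rfl ha) c (hφ.concept a ha c hc),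
    fun a ha b hb s hs => hψ.role _ (hφ.map_mem_nbhd le_rfl ha) _ (hφ.map_mem_nbhd le_rfl hb) s
      (hφ.role a ha b hb s hs)⟩

/-- There is a colour-preserving homomorphism from the `m`-neighbourhood of `x` to that of `y`
sending `x` to `y`. -/
def NbhdMaps (I : Interp Cn Rn) (κ : I.α → Option Γ) (m : ℕ) (x y : I.α) : Prop :=
  ∃ φ, LocalHom I κ m x φ ∧ φ x = y

lemma NbhdMaps.refl (m : ℕ) (x : I.α) : NbhdMaps I κ m x x :=
  ⟨id, ⟨fun _ _ => rfl, fun _ _ _ h => h, fun _ _ _ _ _ h => h⟩, rfl⟩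

lemma NbhdMaps.trans {m : ℕ} {x y z : I.α} (h₁ : NbhdMaps I κ m x y)
    (h₂ : NbhdMaps I κ m y z) : NbhdMaps I κ m x z := by
  obtain ⟨φ, hφ, rfl⟩ := h₁
  obtain ⟨ψ, hψ, rfl⟩ := h₂
  exact ⟨ψ ∘ φ, hψ.comp hφ, rfl⟩

lemma NbhdMaps.mono {m n : ℕ} (hnm : n ≤ m) {x y : I.α} (h : NbhdMaps I κ m x y) :
    NbhdMaps I κ n x y := by
  obtain ⟨φ, hφ, hy⟩ := h
  exact ⟨φ, hφ.of_nbhd fun _ => nbhd_mono hnm, hy⟩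

lemma NbhdMaps.colour_eq {m : ℕ} {x y : I.α} (h : NbhdMaps I κ m x y) : κ y = κ x := by
  obtain ⟨φ, hφ, rfl⟩ := h
  exact hφ.colour x (mem_nbhd_self I m x)

lemma NbhdMaps.exists_adj {m : ℕ} {x y x' : I.α} (h : NbhdMaps I κ (m + 1) x y)
    (hx : Adj I x x') : ∃ y', Adj I y y' ∧ NbhdMaps I κ m x' y' := by
  obtain ⟨φ, hφ, rfl⟩ := h
  refine ⟨φ x', hφ.adj (mem_nbhd_self I _ x) (nbhd_mono (by omega) hx.mem_nbhd_one) hx, φ,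
    hφ.of_nbhd fun a ha => ?_, rfl⟩
  exact nbhd_mono (by omega) (nbhd_trans hx.mem_nbhd_one ha)

lemma NbhdMaps.of_colourHom {m : ℕ} {x y : I.α}
    (h : ∃ f : (I.restrict (Nbhd I m x)).α → (I.restrict (Nbhd I m y)).α,
      ColourHom (I.restrict (Nbhd I m x)) (I.restrict (Nbhd I m y))
        (fun a => κ a.val) (fun a => κ a.val) f ∧
      (f ⟨x, mem_nbhd_self I m x⟩ : I.α) = y) : NbhdMaps I κ m x y := by
  classical
  obtain ⟨f, ⟨⟨hA, hr⟩, hnone, hsome⟩, hfx⟩ := h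
  let φ : I.α → I.α := fun a => if ha : a ∈ Nbhd I m x then (f ⟨a, ha⟩ : I.α) else a
  have hφ : ∀ a (ha : a ∈ Nbhd I m x), φ a = f ⟨a, ha⟩ := fun a ha => dif_pos ha
  refine ⟨φ, ⟨fun a ha => ?_, fun a ha c hc => ?_, fun a ha b hb s hs => ?_⟩, ?_⟩
  · rw [hφ a ha]
    cases hc : κ a with
    | none => exact (hnone ⟨a, ha⟩).1 hc
    | some γ => exact hsome ⟨a, ha⟩ γ hc
  · rw [hφ a ha]
    exact hA c ⟨a, ha⟩ hc
  · rw [hφ a ha, hφ b hb]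
    exact hr s ⟨a, ha⟩ ⟨b, hb⟩ hs
  · rw [hφ x (mem_nbhd_self I m x), hfx]

/-- Neighbourhood equivalence, phrased with neighbourhood maps. -/
structure MutualMaps (I : Interp Cn Rn) (κ : I.α → Option Γ) (m : ℕ) (x y : I.α) : Prop where
  eq_of_none : κ x = none → y = x
  fwd : NbhdMaps I κ m x y
  bwd : NbhdMaps I κ m y x

lemma MutualMaps.refl (m : ℕ) (x : I.α) : MutualMaps I κ m x x :=
  ⟨fun _ => rfl, .refl m x, .refl m x⟩

lemma MutualMaps.symm {m : ℕ} {x y : I.α} (h : MutualMaps I κ m x y) : MutualMaps I κ m y x :=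
  ⟨fun hy => (h.eq_of_none (h.fwd.colour_eq.symm.trans hy)).symm, h.bwd, h.fwd⟩

lemma MutualMaps.trans {m : ℕ} {x y z : I.α} (h₁ : MutualMaps I κ m x y)
    (h₂ : MutualMaps I κ m y z) : MutualMaps I κ m x z :=
  ⟨fun hx => (h₂.eq_of_none (h₁.fwd.colour_eq.trans hx)).trans (h₁.eq_of_none hx),
    h₁.fwd.trans h₂.fwd, h₂.bwd.trans h₁.bwd⟩

lemma NbhdEquiv.mutualMaps {m : ℕ} {x y : I.α} (h : NbhdEquiv I κ m x y) :
    MutualMaps I κ m x y := by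
  rcases h with rfl | ⟨⟨γ, hx, -⟩, hto, hinv⟩
  · exact .refl m x
  · exact ⟨fun h => by simp [hx] at h, .of_colourHom hto, .of_colourHom hinv⟩

lemma mutualMaps_of_quot_eq {m : ℕ} {x y : I.α}
    (h : Quot.mk (NbhdEquiv I κ m) x = Quot.mk (NbhdEquiv I κ m) y) : MutualMaps I κ m x y := by
  have h' := Quot.eqvGen_exact h
  clear h
  induction h' with
  | rel _ _ h => exact h.mutualMaps
  | refl x => exact .refl m x
  | symm _ _ _ ih => exact ih.symm
  | trans _ _ _ _ _ ih₁ ih₂ => exact ih₁.trans ih₂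

end LocalHom

section Lifting

variable {Cn Rn Γ : Type} {I Q : Interp Cn Rn} {κ : I.α → Option Γ} {K : ℕ} {ρ : Q.α → I.α}

/-- The Gaifman graph of an interpretation. -/
def gaifman (Q : Interp Cn Rn) : SimpleGraph Q.α := SimpleGraph.fromRel (Adj Q)

lemma gaifman_adj_of_role {s : Rn} {a b : Q.α} (hab : a ≠ b) (h : Q.r s a b) :
    Q.gaifman.Adj a b :=
  (SimpleGraph.fromRel_adj _ _ _).2 ⟨hab, Or.inl ⟨s, Or.inl h⟩⟩

/-- The map `ρ` is a homomorphism up to replacing elements of `I` by `K`-equivalent ones. -/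
structure IsHomUpTo (Q I : Interp Cn Rn) (κ : I.α → Option Γ) (K : ℕ) (ρ : Q.α → I.α) :
    Prop where
  concept : ∀ c a, a ∈ Q.A c → ∃ x, MutualMaps I κ K (ρ a) x ∧ x ∈ I.A c
  role : ∀ s a b, Q.r s a b →
    ∃ x y, MutualMaps I κ K (ρ a) x ∧ MutualMaps I κ K (ρ b) y ∧ I.r s x y

lemma exists_isHomUpTo {h : Q.α → (I.quot (NbhdEquiv I κ K)).α}
    (hh : IsHom Q (I.quot (NbhdEquiv I κ K)) h) : ∃ ρ, IsHomUpTo Q I κ K ρ := by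
  choose ρ hρ using fun q => Quot.exists_rep (h q)
  refine ⟨ρ, fun c a ha => ?_, fun s a b hab => ?_⟩
  · obtain ⟨x, hx, hxc⟩ := hh.1 c a ha
    exact ⟨x, mutualMaps_of_quot_eq ((hρ a).trans hx), hxc⟩
  · obtain ⟨x, y, hx, hy, hxy⟩ := hh.2 s a b hab
    exact ⟨x, y, mutualMaps_of_quot_eq ((hρ a).trans hx),
      mutualMaps_of_quot_eq ((hρ b).trans hy), hxy⟩

lemma IsHomUpTo.adj (hρ : IsHomUpTo Q I κ K ρ) {a b : Q.α} (hab : Q.gaifman.Adj a b) :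
    ∃ x y, MutualMaps I κ K (ρ a) x ∧ MutualMaps I κ K (ρ b) y ∧ Adj I x y := by
  have h : Adj Q a b := ((SimpleGraph.fromRel_adj _ _ _).1 hab).2.elim id Adj.symm
  obtain ⟨s, h | h⟩ := h
  · obtain ⟨x, y, hx, hy, hxy⟩ := hρ.role s a b h
    exact ⟨x, y, hx, hy, s, Or.inl hxy⟩
  · obtain ⟨y, x, hy, hx, hxy⟩ := hρ.role s b a h
    exact ⟨x, y, hx, hy, s, Or.inr hxy⟩

lemma IsHomUpTo.exists_nbhdMaps_of_walk (hρ : IsHomUpTo Q I κ K ρ) {a b : Q.α}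
    (w : Q.gaifman.Walk a b) {m : ℕ} (hm : m + w.length ≤ K) {y₀ : I.α}
    (hy₀ : NbhdMaps I κ (m + w.length) (ρ a) y₀) :
    ∃ y ∈ Nbhd I w.length y₀, NbhdMaps I κ m (ρ b) y := by
  induction w generalizing y₀ with
  | nil => exact ⟨y₀, mem_nbhd_self I _ _, hy₀⟩
  | cons hab w ih =>
    rw [SimpleGraph.Walk.length_cons] at *
    obtain ⟨x, x', hx, hx', hxx'⟩ := hρ.adj hab
    obtain ⟨y', hy', hmap⟩ :=
      NbhdMaps.exists_adj (m := m + w.length) ((hx.bwd.mono hm).trans hy₀) hxx'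
    obtain ⟨y, hy, hmy⟩ := ih (by omega) ((hx'.fwd.mono (by omega)).trans hmap)
    exact ⟨y, nbhd_mono (by omega) (nbhd_trans hy'.mem_nbhd_one hy), hmy⟩

/-- A lift of `Q` into `I` whose values at the elements with coloured image are determined by
their colours on each component of `Q`. -/
structure ColouredLift (Q I : Interp Cn Rn) (κ : I.α → Option Γ) (d : ℕ) (ρ f : Q.α → I.α) :
    Prop where
  maps : ∀ q, NbhdMaps I κ (d + 1) (ρ q) (f q)
  unique : ∀ q q', κ (ρ q') ≠ none → Q.gaifman.Reachable q q' →
    ∀ z ∈ Nbhd I (d + 1) (f q), κ z = κ (ρ q') → z = f q'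

lemma IsHomUpTo.exists_colouredLift (hρ : IsHomUpTo Q I κ K ρ) [Finite Q.α] {d : ℕ}
    (hd : Nat.card Q.α ≤ d + 1) (hK : 2 * d + 1 ≤ K) (hsparse : Sparse I κ K) :
    ∃ f, ColouredLift Q I κ d ρ f := by
  classical
  have := Fintype.ofFinite Q.α
  choose t ht using fun D : Q.gaifman.ConnectedComponent => D.exists_rep
  have hf : ∀ q, ∃ y, y ∈ Nbhd I d (ρ (t (Q.gaifman.connectedComponentMk q))) ∧
      NbhdMaps I κ (d + 1) (ρ q) y := by
    intro q
    obtain ⟨w, hw⟩ := (SimpleGraph.ConnectedComponent.exact (ht (Q.gaifman.connectedComponentMk q))).exists_isPath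
    have hlen : w.length ≤ d := by
      have := hw.length_lt
      rw [← Nat.card_eq_fintype_card] at this
      omega
    obtain ⟨y, hy, hmy⟩ :=
      hρ.exists_nbhdMaps_of_walk w (m := d + 1) (by omega) (NbhdMaps.refl _ _)
    exact ⟨y, nbhd_mono hlen hy, hmy⟩
  choose f hf using hf
  refine ⟨f, fun q => (hf q).2, fun q q' hq' hqq' z hz hzc => ?_⟩
  have hcc : Q.gaifman.connectedComponentMk q = Q.gaifman.connectedComponentMk q' :=
    SimpleGraph.ConnectedComponent.sound hqq'
  have hfq' := hf q'
  rw [← hcc] at hfq'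
  have hc' := hfq'.2.colour_eq
  obtain ⟨γ, hγ⟩ := Option.ne_none_iff_exists'.1 hq'
  by_contra hne
  exact hsparse _ z (f q') (nbhd_mono (by omega) (nbhd_trans (hf q).1 hz))
    (nbhd_mono (by omega) hfq'.1) ⟨γ, hzc.trans hγ⟩ ⟨γ, hc'.trans hγ⟩ hne (hzc.trans hc'.symm)

/-- The part of the Gaifman graph of `Q` spanned by the elements with uncoloured image. -/
def uncolouredGraph (κ : I.α → Option Γ) (ρ : Q.α → I.α) : SimpleGraph Q.α where
  Adj a b := Q.gaifman.Adj a b ∧ κ (ρ a) = none ∧ κ (ρ b) = none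
  symm := ⟨fun _ _ h => ⟨h.1.symm, h.2.2, h.2.1⟩⟩
  loopless := ⟨fun _ h => h.1.ne rfl⟩

lemma uncolouredGraph_le : uncolouredGraph κ ρ ≤ Q.gaifman := fun _ _ h => h.1

lemma colour_eq_none_of_mem_support {a b : Q.α} (w : (uncolouredGraph κ ρ).Walk a b)
    (ha : κ (ρ a) = none) {v : Q.α} (hv : v ∈ w.support) : κ (ρ v) = none := by
  induction w with
  | nil => simp only [SimpleGraph.Walk.support_nil, List.mem_singleton] at hv; rwa [hv]
  | cons h w ih =>
    rw [SimpleGraph.Walk.support_cons, List.mem_cons] at hv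
    rcases hv with rfl | hv
    · exact ha
    · exact ih h.2.2 hv

lemma IsHomUpTo.mem_nbhd_of_walk (hρ : IsHomUpTo Q I κ K ρ) {a b : Q.α}
    (w : (uncolouredGraph κ ρ).Walk a b) : ρ b ∈ Nbhd I w.length (ρ a) := by
  induction w with
  | nil => exact mem_nbhd_self I _ _
  | cons h w ih =>
    obtain ⟨x, y, hx, hy, hxy⟩ := hρ.adj h.1
    rw [hx.eq_of_none h.2.1, hy.eq_of_none h.2.2] at hxy
    rw [SimpleGraph.Walk.length_cons]
    exact nbhd_mono (by omega) (nbhd_trans hxy.mem_nbhd_one ih)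

/-- `ψ` lifts the uncoloured elements in the component `C`, compatibly with the lift `f` of the
coloured ones. -/
structure UncolouredLift (κ : I.α → Option Γ) (ρ f : Q.α → I.α)
    (C : (uncolouredGraph κ ρ).ConnectedComponent) (ψ : Q.α → I.α) : Prop where
  concept : ∀ p, κ (ρ p) = none → (uncolouredGraph κ ρ).connectedComponentMk p = C →
    ∀ c, p ∈ Q.A c → ψ p ∈ I.A c
  role : ∀ p p', κ (ρ p) = none → (uncolouredGraph κ ρ).connectedComponentMk p = C →
    κ (ρ p') = none → (uncolouredGraph κ ρ).connectedComponentMk p' = C →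
    ∀ s, Q.r s p p' → I.r s (ψ p) (ψ p')
  role_right : ∀ p q, κ (ρ p) = none → (uncolouredGraph κ ρ).connectedComponentMk p = C →
    κ (ρ q) ≠ none → ∀ s, Q.r s p q → I.r s (ψ p) (f q)
  role_left : ∀ p q, κ (ρ p) = none → (uncolouredGraph κ ρ).connectedComponentMk p = C →
    κ (ρ q) ≠ none → ∀ s, Q.r s q p → I.r s (f q) (ψ p)

lemma IsHomUpTo.concept_of_none (hρ : IsHomUpTo Q I κ K ρ) {p : Q.α} (hp : κ (ρ p) = none)
    {c : Cn} (hc : p ∈ Q.A c) : ρ p ∈ I.A c := by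
  obtain ⟨x, hx, hxc⟩ := hρ.concept c p hc
  rwa [hx.eq_of_none hp] at hxc

lemma IsHomUpTo.role_of_none (hρ : IsHomUpTo Q I κ K ρ) {p p' : Q.α} (hp : κ (ρ p) = none)
    (hp' : κ (ρ p') = none) {s : Rn} (hs : Q.r s p p') : I.r s (ρ p) (ρ p') := by
  obtain ⟨x, y, hx, hy, hxy⟩ := hρ.role s p p' hs
  rwa [hx.eq_of_none hp, hy.eq_of_none hp'] at hxy

lemma IsHomUpTo.exists_uncolouredLift (hρ : IsHomUpTo Q I κ K ρ) [Finite Q.α] {d : ℕ}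
    (hd : Nat.card Q.α ≤ d + 1) (hK : d + 1 ≤ K) {f : Q.α → I.α}
    (hf : ColouredLift Q I κ d ρ f) (C : (uncolouredGraph κ ρ).ConnectedComponent) :
    ∃ ψ, UncolouredLift κ ρ f C ψ := by
  classical
  have := Fintype.ofFinite Q.α
  have hadj : ∀ {p q : Q.α}, κ (ρ p) = none → κ (ρ q) ≠ none →
      ∀ {s}, Q.r s p q ∨ Q.r s q p → Q.gaifman.Adj q p := by
    intro p q hp hq s h
    have hne : q ≠ p := by rintro rfl; exact hq hp
    exact h.elim (fun h => (gaifman_adj_of_role hne.symm h).symm) (gaifman_adj_of_role hne)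
  by_cases hbd : ∃ p q, κ (ρ p) = none ∧ (uncolouredGraph κ ρ).connectedComponentMk p = C ∧
      κ (ρ q) ≠ none ∧ Q.gaifman.Adj q p
  · obtain ⟨p₀, q₀, hp₀, rfl, hq₀, hqp⟩ := hbd
    obtain ⟨x₀, y₀, hx₀, hy₀, hxy⟩ := hρ.adj hqp
    rw [hy₀.eq_of_none hp₀] at hxy
    obtain ⟨φ, hφ, hφx⟩ := (hx₀.bwd.mono hK).trans (hf.maps q₀)
    have hreach : ∀ p, (uncolouredGraph κ ρ).connectedComponentMk p =
        (uncolouredGraph κ ρ).connectedComponentMk p₀ →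
        Q.gaifman.Reachable q₀ p ∧ ρ p ∈ Nbhd I d x₀ := by
      intro p hp
      obtain ⟨w, hw⟩ := (SimpleGraph.ConnectedComponent.exact hp.symm).exists_isPath
      let w' : Q.gaifman.Walk q₀ p := .cons hqp (w.mapLe uncolouredGraph_le)
      have hw' : w'.IsPath := by
        refine (SimpleGraph.Walk.cons_isPath_iff _ _).2 ⟨?_, fun hmem => ?_⟩
        · exact hw.mapLe uncolouredGraph_le
        · rw [SimpleGraph.Walk.support_mapLe_eq_support] at hmem
          exact hq₀ (colour_eq_none_of_mem_support w hp₀ hmem)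
      have hlen := hw'.length_lt
      have hlen' : w'.length = w.length + 1 := by simp [w']
      rw [← Nat.card_eq_fintype_card] at hlen
      exact ⟨⟨w'⟩, nbhd_mono (by omega) (nbhd_trans hxy.mem_nbhd_one (hρ.mem_nbhd_of_walk w))⟩
    have hmem : ∀ p, (uncolouredGraph κ ρ).connectedComponentMk p =
        (uncolouredGraph κ ρ).connectedComponentMk p₀ → ρ p ∈ Nbhd I (d + 1) x₀ :=
      fun p hp => nbhd_mono d.le_succ (hreach p hp).2
    have hnext : ∀ p q, κ (ρ p) = none → (uncolouredGraph κ ρ).connectedComponentMk p =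
        (uncolouredGraph κ ρ).connectedComponentMk p₀ → κ (ρ q) ≠ none → Q.gaifman.Adj q p →
        ∀ y, MutualMaps I κ K (ρ q) y → Adj I (ρ p) y → y ∈ Nbhd I (d + 1) x₀ ∧ φ y = f q := by
      intro p q hp hpC hq hqp y hy hpy
      have hyN := hpy.mem_nbhd_succ (hreach p hpC).2
      refine ⟨hyN, hf.unique q₀ q hq ((hreach p hpC).1.trans hqp.symm.reachable) _ ?_ ?_⟩
      · rw [← hφx]
        exact hφ.map_mem_nbhd le_rfl hyN
      · exact (hφ.colour y hyN).trans hy.fwd.colour_eq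
    refine ⟨φ ∘ ρ, fun p hp hpC c hc => ?_, fun p p' hp hpC hp' hpC' s hs => ?_,
      fun p q hp hpC hq s hs => ?_, fun p q hp hpC hq s hs => ?_⟩
    · exact hφ.concept _ (hmem p hpC) c (hρ.concept_of_none hp hc)
    · exact hφ.role _ (hmem p hpC) _ (hmem p' hpC') s (hρ.role_of_none hp hp' hs)
    · obtain ⟨x, y, hx, hy, hr⟩ := hρ.role s p q hs
      rw [hx.eq_of_none hp] at hr
      obtain ⟨hyN, hyf⟩ := hnext p q hp hpC hq (hadj hp hq (Or.inl hs)) y hy ⟨s, Or.inl hr⟩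
      rw [← hyf]
      exact hφ.role _ (hmem p hpC) _ hyN s hr
    · obtain ⟨y, x, hy, hx, hr⟩ := hρ.role s q p hs
      rw [hx.eq_of_none hp] at hr
      obtain ⟨hyN, hyf⟩ := hnext p q hp hpC hq (hadj hp hq (Or.inr hs)) y hy ⟨s, Or.inr hr⟩
      rw [← hyf]
      exact hφ.role _ hyN _ (hmem p hpC) s hr
  · refine ⟨ρ, fun p hp _ c hc => hρ.concept_of_none hp hc,
      fun p p' hp _ hp' _ s hs => hρ.role_of_none hp hp' hs,
      fun p q hp hpC hq s hs => ?_, fun p q hp hpC hq s hs => ?_⟩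
    · exact absurd ⟨p, q, hp, hpC, hq, hadj hp hq (Or.inl hs)⟩ hbd
    · exact absurd ⟨p, q, hp, hpC, hq, hadj hp hq (Or.inr hs)⟩ hbd

lemma IsHomUpTo.role_lift (hρ : IsHomUpTo Q I κ K ρ) {d : ℕ} (hK : d + 1 ≤ K)
    {f : Q.α → I.α} (hf : ColouredLift Q I κ d ρ f) {a b : Q.α}
    (hb : κ (ρ b) ≠ none) {s : Rn} (hs : Q.r s a b) : I.r s (f a) (f b) := by
  obtain ⟨x, y, hx, hy, hr⟩ := hρ.role s a b hs
  obtain ⟨φ, hφ, hφx⟩ := (hx.bwd.mono hK).trans (hf.maps a)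
  have hyN : y ∈ Nbhd I (d + 1) x :=
    nbhd_mono (by omega) (Adj.mem_nbhd_one ⟨s, Or.inl hr⟩)
  have hreach : Q.gaifman.Reachable a b := by
    by_cases hab : a = b
    · rw [hab]
    · exact (gaifman_adj_of_role hab hs).reachable
  have hyf : φ y = f b := by
    refine hf.unique a b hb hreach _ ?_ ((hφ.colour y hyN).trans hy.fwd.colour_eq)
    rw [← hφx]
    exact hφ.map_mem_nbhd le_rfl hyN
  rw [← hφx, ← hyf]
  exact hφ.role _ (mem_nbhd_self I _ x) _ hyN s hr

lemma IsHomUpTo.concept_lift (hρ : IsHomUpTo Q I κ K ρ) {d : ℕ} (hK : d + 1 ≤ K)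
    {f : Q.α → I.α} (hf : ColouredLift Q I κ d ρ f) {a : Q.α}
    {c : Cn} (hc : a ∈ Q.A c) : f a ∈ I.A c := by
  obtain ⟨x, hx, hxc⟩ := hρ.concept c a hc
  obtain ⟨φ, hφ, hφx⟩ := (hx.bwd.mono hK).trans (hf.maps a)
  rw [← hφx]
  exact hφ.concept x (mem_nbhd_self I _ x) c hxc

lemma IsHomUpTo.exists_isHom (hρ : IsHomUpTo Q I κ K ρ) [Finite Q.α] {d : ℕ}
    (hd : Nat.card Q.α ≤ d + 1) (hK : 2 * d + 1 ≤ K) (hsparse : Sparse I κ K) :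
    ∃ h, IsHom Q I h := by
  classical
  obtain ⟨f, hf⟩ := hρ.exists_colouredLift hd hK hsparse
  have hK' : d + 1 ≤ K := by omega
  choose ψ hψ using hρ.exists_uncolouredLift hd hK' hf
  let F : Q.α → I.α := fun a =>
    if κ (ρ a) = none then ψ ((uncolouredGraph κ ρ).connectedComponentMk a) a else f a
  have hF₀ : ∀ {a}, κ (ρ a) = none →
      F a = ψ ((uncolouredGraph κ ρ).connectedComponentMk a) a := fun h => if_pos h
  have hF₁ : ∀ {a}, κ (ρ a) ≠ none → F a = f a := fun h => if_neg h
  refine ⟨F, fun c a hc => ?_, fun s a b hs => ?_⟩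
  · by_cases ha : κ (ρ a) = none
    · rw [hF₀ ha]
      exact (hψ _).concept a ha rfl c hc
    · rw [hF₁ ha]
      exact hρ.concept_lift hK' hf hc
  · by_cases ha : κ (ρ a) = none <;> by_cases hb : κ (ρ b) = none
    · have hab : (uncolouredGraph κ ρ).connectedComponentMk b =
          (uncolouredGraph κ ρ).connectedComponentMk a := by
        by_cases hne : a = b
        · rw [hne]
        · have hadj : (uncolouredGraph κ ρ).Adj a b := ⟨gaifman_adj_of_role hne hs, ha, hb⟩
          exact SimpleGraph.ConnectedComponent.sound hadj.symm.reachable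
      rw [hF₀ ha, hF₀ hb, hab]
      exact (hψ _).role a b ha rfl hb hab s hs
    · rw [hF₀ ha, hF₁ hb]
      exact (hψ _).role_right a b ha rfl hb s hs
    · rw [hF₁ ha, hF₀ hb]
      exact (hψ _).role_left b a hb rfl ha s hs
    · rw [hF₁ ha, hF₁ hb]
      exact hρ.role_lift hK' hf hb hs

end Lifting

end Interp

open Interp in
/-- Coloured blocking theorem: for `K = 2·k³` and a `K`-sparse coloured interpretation
`(I, κ)`, a finite interpretation `Q` with at most `k` elements maps homomorphically
into `I` iff it maps homomorphically into the quotient `I/∼_K` by the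
`K`-neighbourhood equivalence. -/
theorem coloured_blocking {Cn Rn Γ : Type} (k K : ℕ) (hK : K = 2 * k ^ 3)
    (I : Interp Cn Rn) (κ : I.α → Option Γ) (hsparse : Sparse I κ K)
    (Q : Interp Cn Rn) (hfin : Finite Q.α) (hcard : Nat.card Q.α ≤ k) :
    (∃ h : Q.α → I.α, IsHom Q I h) ↔
    (∃ h : Q.α → (I.quot (NbhdEquiv I κ K)).α,
      IsHom Q (I.quot (NbhdEquiv I κ K)) h) := by
  constructor
  · rintro ⟨h, hA, hr⟩
    exact ⟨fun a => Quot.mk _ (h a), fun c a ha => ⟨h a, rfl, hA c a ha⟩,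
      fun s a b hab => ⟨h a, h b, rfl, rfl, hr s a b hab⟩⟩
  · rintro ⟨h, hh⟩
    rcases isEmpty_or_nonempty Q.α with hQ | hQ
    · exact ⟨isEmptyElim, fun _ a => isEmptyElim a, fun _ a => isEmptyElim a⟩
    · obtain ⟨ρ, hρ⟩ := exists_isHomUpTo hh
      have hpos : 0 < Nat.card Q.α := Nat.card_pos
      have hk : k ≤ k ^ 3 := Nat.le_self_pow (by norm_num) k
      exact hρ.exists_isHom (d := k - 1) (by omega) (by omega) hsparse
end

section
/- Short critical paths lemma: Let I be a single-role interpretation over a finite type C of concept names with ℓ = card C, such that t_I is transitive, let F ⊆ α_I be a finite set of critical elements, and let b ∈ α_I. Then there exists a subset S ⊆ α_I with b ∈ S such that, for the induced subinterpretation J = I↾S: rch_J(u) = rch_I(u) for every u ∈ S, and every finite sequence u_1, …, u_m of pairwise distinct elements of (S ∩ F) \ {b} with t_I u_i u_{i+1} for all i < m has at most ℓ elements (m ≤ ℓ). -/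
/-- A single-role interpretation over a type `C` of concept names. -/
structure SInterp (C : Type) where
  α : Type
  A : C → Set α
  t : α → α → Prop

namespace SInterp

variable {C : Type}

/-- The (unary) type of an element. -/
def tp (I : SInterp C) (a : I.α) : Set C := {c | a ∈ I.A c}

/-- `b` is `t`-reachable from `a`: there is a path of length at least one. -/
def Reach (I : SInterp C) (a b : I.α) : Prop := Relation.TransGen I.t a b

/-- The set of concept names reachable from `a`. -/
def rch (I : SInterp C) (a : I.α) : Set C := {c | ∃ b, Reach I a b ∧ b ∈ I.A c}

/-- A homomorphism of single-role interpretations. -/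
def IsHom (I J : SInterp C) (h : I.α → J.α) : Prop :=
  (∀ (c : C) (a : I.α), a ∈ I.A c → h a ∈ J.A c) ∧
  (∀ a b : I.α, I.t a b → J.t (h a) (h b))

/-- A `t`-strong homomorphism: preserves unary types and reachable concept names. -/
def TStrong (I J : SInterp C) (h : I.α → J.α) : Prop :=
  IsHom I J h ∧ ∀ a : I.α, tp I a = tp J (h a) ∧ rch I a = rch J (h a)

/-- The induced subinterpretation on a subset of the domain. -/
abbrev restrict (I : SInterp C) (S : Set I.α) : SInterp C where
  α := S
  A := fun c => {a | (a : I.α) ∈ I.A c}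
  t := fun a b => I.t (a : I.α) (b : I.α)

end SInterp

namespace SInterp

variable {C : Type}

/-- A set is `t`-saturated if every concept name on a `t`-successor of one of its elements
already occurs on a `t`-successor inside the set. -/
def Saturated (I : SInterp C) (S : Set I.α) : Prop :=
  ∀ u ∈ S, ∀ w c, I.t u w → w ∈ I.A c → ∃ w' ∈ S, I.t u w' ∧ w' ∈ I.A c

theorem Saturated.rch_restrict {I : SInterp C} (htrans : Transitive I.t) {S : Set I.α}
    (hS : I.Saturated S) (u : I.α) (hu : u ∈ S) : rch (I.restrict S) ⟨u, hu⟩ = rch I u := by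
  have : IsTrans I.α I.t := ⟨htrans⟩
  ext c
  constructor
  · rintro ⟨w, hw, hc⟩
    exact ⟨w, Relation.TransGen.lift (p := I.t) (Subtype.val : S → I.α) (fun _ _ h => h) _ _ hw, hc⟩
  · rintro ⟨w, hw, hc⟩
    have huw : I.t u w := by
      rwa [Reach, Relation.transGen_eq_self] at hw
    obtain ⟨w', hw', huw', hc'⟩ := hS u hu w c huw hc
    exact ⟨⟨w', hw'⟩, Relation.TransGen.single huw', hc'⟩

/-- An element that cannot be removed from a saturated set carries a concept name which is
carried by none of its other `t`-successors in the set. -/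
theorem Saturated.exists_private_concept {I : SInterp C} (htrans : Transitive I.t)
    {S : Set I.α} (hS : I.Saturated S) {u : I.α} (hu : ¬ I.Saturated (S \ {u})) :
    ∃ c, u ∈ I.A c ∧ ∀ w ∈ S, I.t u w → w ∈ I.A c → w = u := by
  simp only [Saturated, not_forall, not_exists, not_and] at hu
  obtain ⟨v, hv, w, c, hvw, hwc, hc⟩ := hu
  obtain ⟨w', hw', hvw', hwc'⟩ := hS v hv.1 w c hvw hwc
  obtain rfl : w' = u := by
    by_contra hne
    exact hc w' ⟨hw', hne⟩ hvw' hwc'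
  refine ⟨c, hwc', fun x hx hux hxc => ?_⟩
  by_contra hne
  exact hc x ⟨hx, hne⟩ (htrans hvw' hux) hxc

/-- There is a saturated set containing `b` from which no element of the finite set `F`
other than `b` can be removed. -/
theorem exists_saturated_irredundant (I : SInterp C) {F : Set I.α} (hF : F.Finite) (b : I.α) :
    ∃ S : Set I.α, b ∈ S ∧ I.Saturated S ∧
      ∀ u ∈ S, u ∈ F → u ≠ b → ¬ I.Saturated (S \ {u}) := by
  have hfin : {G : Set I.α | G ⊆ F ∧ b ∉ G ∧ I.Saturated Gᶜ}.Finite :=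
    hF.finite_subsets.subset fun _ h => h.1
  have hempty : ∅ ∈ {G : Set I.α | G ⊆ F ∧ b ∉ G ∧ I.Saturated Gᶜ} :=
    ⟨Set.empty_subset F, Set.notMem_empty b, fun _ _ w _ hw hc => ⟨w, by simp, hw, hc⟩⟩
  obtain ⟨G, ⟨hGF, hbG, hG⟩, hmax⟩ := hfin.exists_maximal ⟨∅, hempty⟩
  refine ⟨Gᶜ, hbG, hG, fun u huG huF hub hsat => huG ?_⟩
  refine hmax ⟨Set.insert_subset huF hGF, ?_, ?_⟩ (Set.subset_insert u G) (Set.mem_insert u G)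
  · rintro (h | h)
    exacts [hub h.symm, hbG h]
  · convert hsat using 1
    ext x
    simp [and_comm]

end SInterp

open SInterp in
/-- Short critical paths lemma: for a transitive single-role interpretation `I` over a
finite type `C` of concept names, a finite set `F` of critical elements, and `b ∈ α_I`,
there is a subset `S ∋ b` such that the induced subinterpretation `J = I ↾ S` has the
same reachable concept names as `I` at every element of `S`, and every simple forward
`t`-path through critical elements of `S` avoiding `b` has length at most `card C`. -/
theorem short_critical_paths {C : Type} [Fintype C] (I : SInterp C)
    (htrans : Transitive I.t) (F : Set I.α) (hF : F.Finite) (b : I.α) :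
    ∃ S : Set I.α, b ∈ S ∧
      (∀ (u : I.α) (hu : u ∈ S), rch (I.restrict S) ⟨u, hu⟩ = rch I u) ∧
      (∀ L : List I.α, L.Nodup → (∀ x ∈ L, x ∈ S ∧ x ∈ F ∧ x ≠ b) →
        L.Chain' I.t → L.length ≤ Fintype.card C) := by
  obtain ⟨S, hb, hS, hirr⟩ := exists_saturated_irredundant I hF b
  refine ⟨S, hb, hS.rch_restrict htrans, fun L hL hLS hchain => ?_⟩
  have : IsTrans I.α I.t := ⟨htrans⟩
  have hpw : L.Pairwise fun x y => I.t x y ∧ x ≠ y := hchain.pairwise.and hL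
  have hpriv : ∀ x, (x ∈ S ∧ x ∈ F ∧ x ≠ b) →
      ∃ c, x ∈ I.A c ∧ ∀ w ∈ S, I.t x w → w ∈ I.A c → w = x := fun x hx =>
    hS.exists_private_concept htrans (hirr x hx.1 hx.2.1 hx.2.2)
  choose f hfA hf using hpriv
  have hnodup : (L.pmap f hLS).Nodup :=
    hpw.pmap hLS fun x hx y hy hxy heq =>
      hxy.2 (hf x hx y hy.1 hxy.1 (heq ▸ hfA y hy)).symm
  simpa using hnodup.length_le_card
end

section
/- t-strong homomorphisms reflect TBox models and query countermodels: Let I and I' be single-role interpretations over C with t_I and t_{I'} transitive, and let h : I → I' be a t-strong homomorphism. Then for every normalized TBox T over C, if I' models T then I models T; and for every UCQ Q over C, if I' does not satisfy Q then I does not satisfy Q. -/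
/-- A normalized concept inclusion: `⊓S ⊑ ⊔T`, `c ⊑ ∀t.d`, or `c ⊑ ∃t.d`. -/
inductive NCI (C : Type) : Type
  | conj : Finset C → Finset C → NCI C
  | univ : C → C → NCI C
  | exis : C → C → NCI C

/-- Satisfaction of a normalized concept inclusion in a single-role interpretation. -/
def satCI {C : Type} (I : SInterp C) : NCI C → Prop
  | NCI.conj S T => ∀ a : I.α, (∀ c ∈ S, a ∈ I.A c) → ∃ c ∈ T, a ∈ I.A c
  | NCI.univ c d => ∀ a b : I.α, a ∈ I.A c → I.t a b → b ∈ I.A d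
  | NCI.exis c d => ∀ a : I.α, a ∈ I.A c → ∃ b, I.t a b ∧ b ∈ I.A d

/-- `I` models a normalized TBox: `t` is transitive and all inclusions are satisfied. -/
def ModelsTBox {C : Type} (I : SInterp C) (T : Set (NCI C)) : Prop :=
  Transitive I.t ∧ ∀ ci ∈ T, satCI I ci

/-- A conjunctive query over concept names `C`, with a single (transitive) role. -/
structure CQ (C : Type) where
  V : Type
  fin : Finite V
  unary : Set (C × V)
  binary : Set (V × V)

/-- `I` satisfies a CQ if it has a match. -/
def satCQ {C : Type} (I : SInterp C) (q : CQ C) : Prop :=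
  ∃ π : q.V → I.α,
    (∀ p ∈ q.unary, π p.2 ∈ I.A p.1) ∧ (∀ p ∈ q.binary, I.t (π p.1) (π p.2))

/-- `I` satisfies a UCQ (a finite set of CQs) if it satisfies some CQ in it. -/
def satUCQ {C : Type} (I : SInterp C) (Q : Set (CQ C)) : Prop := ∃ q ∈ Q, satCQ I q

namespace SInterp

variable {C : Type} {I J : SInterp C} {h : I.α → J.α}

theorem TStrong.isHom (hs : TStrong I J h) : IsHom I J h := hs.1

theorem TStrong.mem_iff (hs : TStrong I J h) (c : C) (a : I.α) :
    a ∈ I.A c ↔ h a ∈ J.A c :=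
  Set.ext_iff.mp (hs.2 a).1 c

/-- A `t`-strong homomorphism into `J` lifts successors in `J` of image points, up to a single
concept name. -/
theorem TStrong.exists_t_of_map (hs : TStrong I J h) (hI : Transitive I.t) {d : C} {a : I.α}
    {b : J.α} (hab : J.t (h a) b) (hb : b ∈ J.A d) : ∃ b', I.t a b' ∧ b' ∈ I.A d := by
  have hd : d ∈ rch I a := (hs.2 a).2 ▸ ⟨b, .single hab, hb⟩
  obtain ⟨b', hab', hb'⟩ := hd
  have : IsTrans I.α I.t := ⟨fun _ _ _ => @hI _ _ _⟩
  exact ⟨b', Relation.transGen_eq_self (r := I.t) ▸ hab', hb'⟩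

theorem TStrong.satCI (hs : TStrong I J h) (hI : Transitive I.t) {ci : NCI C}
    (hJ : satCI J ci) : satCI I ci := by
  cases ci with
  | conj S T =>
    intro a ha
    obtain ⟨c, hc, hac⟩ := hJ (h a) fun c hc => hs.isHom.1 c a (ha c hc)
    exact ⟨c, hc, (hs.mem_iff c a).2 hac⟩
  | univ c d =>
    intro a b ha hab
    exact (hs.mem_iff d b).2 (hJ (h a) (h b) (hs.isHom.1 c a ha) (hs.isHom.2 a b hab))
  | exis c d =>
    intro a ha
    obtain ⟨b, hab, hb⟩ := hJ (h a) (hs.isHom.1 c a ha)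
    exact hs.exists_t_of_map hI hab hb

theorem IsHom.satCQ (hh : IsHom I J h) {q : CQ C} : satCQ I q → satCQ J q :=
  fun ⟨π, hu, hb⟩ => ⟨h ∘ π, fun p hp => hh.1 _ _ (hu p hp), fun p hp => hh.2 _ _ (hb p hp)⟩

theorem IsHom.satUCQ (hh : IsHom I J h) {Q : Set (CQ C)} : satUCQ I Q → satUCQ J Q :=
  fun ⟨q, hq, hI⟩ => ⟨q, hq, hh.satCQ hI⟩

end SInterp

open SInterp in
/-- `t`-strong homomorphisms reflect TBox models and query countermodels:
if `h : I → I'` is `t`-strong and both interpretations are transitive, then every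
normalized TBox modelled by `I'` is modelled by `I`, and every UCQ not satisfied by
`I'` is not satisfied by `I`. -/
theorem tstrong_reflects_models_and_countermodels {C : Type} (I I' : SInterp C)
    (hI : Transitive I.t) (hI' : Transitive I'.t)
    (h : I.α → I'.α) (hstrong : TStrong I I' h) :
    (∀ T : Set (NCI C), T.Finite → ModelsTBox I' T → ModelsTBox I T) ∧
    (∀ Q : Set (CQ C), Q.Finite → ¬ satUCQ I' Q → ¬ satUCQ I Q) := by
  exact ⟨fun T _ hT => ⟨hI, fun ci hci => hstrong.satCI hI (hT.2 ci hci)⟩,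
    fun Q _ hQ hsat => hQ (hstrong.isHom.satUCQ hsat)⟩
end

section
/- t-strong homomorphisms reflect existential inclusions: Let I and I' be single-role interpretations over C with t_I transitive, and let h : I → I' be a t-strong homomorphism. Let c, d be concept names. If every a' ∈ A_{I'} c admits some b' with t_{I'} a' b' and b' ∈ A_{I'} d, then every a ∈ A_I c admits some b with t_I a b and b ∈ A_I d. -/
open SInterp in
/-- `t`-strong homomorphisms reflect existential inclusions `c ⊑ ∃t.d`
(for transitive `t_I`). -/
theorem tstrong_reflects_exists {C : Type} (I I' : SInterp C)
    (htrans : Transitive I.t) (h : I.α → I'.α) (hstrong : TStrong I I' h)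
    (c d : C)
    (hI' : ∀ a' : I'.α, a' ∈ I'.A c → ∃ b', I'.t a' b' ∧ b' ∈ I'.A d) :
    ∀ a : I.α, a ∈ I.A c → ∃ b, I.t a b ∧ b ∈ I.A d := by
  intro a ha
  obtain ⟨b', hab', hb'⟩ := hI' (h a) (hstrong.1.1 c a ha)
  have hd : d ∈ rch I a := by
    rw [(hstrong.2 a).2]
    exact ⟨b', Relation.TransGen.single hab', hb'⟩
  obtain ⟨b, hab, hb⟩ := hd
  refine ⟨b, ?_, hb⟩
  clear hb
  induction hab with
  | single hxy => exact hxy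
  | tail _ hyz ih => exact htrans ih hyz
end

section
/- Quasi-unravelling homomorphism: Let I be a single-role interpretation over C with a designated set F ⊆ α_I of critical elements, let a ∈ α_I, and let (Ĩ, a) be the quasi-unravelling of (I, a). Then the map sending each element of Ĩ to the element of I it is a copy of is a homomorphism from Ĩ to the transitive closure I* of I, and it maps the root a to a. Moreover, if every element of I other than a is t-reachable from a in I, then this homomorphism is surjective. -/
namespace SInterp

variable {C : Type}

/-- `u` and `v` are in the same cluster of `I`. -/
def sameCluster (I : SInterp C) (u v : I.α) : Prop :=
  u = v ∨ (Reach I u v ∧ Reach I v u)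

/-- The cluster of `u` in `I`. -/
def cluster (I : SInterp C) (u : I.α) : Set I.α := {v | sameCluster I u v}

/-- The union of all critical clusters of `I` (w.r.t. the critical set `F`). -/
def DeltaF (I : SInterp C) (F : Set I.α) : Set I.α :=
  {v | ∃ f ∈ F, sameCluster I v f}

/-- `K` is a critical cluster of `I`. -/
def IsCriticalCluster (I : SInterp C) (F : Set I.α) (K : Set I.α) : Prop :=
  (∃ u : I.α, K = cluster I u) ∧ ∃ f ∈ F, f ∈ K

/-- `K_a`: the cluster of `a` if it is critical, and `{a}` otherwise. -/
def Ka (I : SInterp C) (F : Set I.α) (a : I.α) : Set I.α :=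
  {v | v = a ∨ (sameCluster I a v ∧ ∃ f ∈ F, sameCluster I a f)}

/-- `p` is a path in `I` beginning in a successor of an element of `K` and visiting
only elements outside `Δ_F ∪ {a}`. -/
def IsQUPath (I : SInterp C) (F : Set I.α) (a : I.α) (K : Set I.α)
    (p : List I.α) : Prop :=
  p ≠ [] ∧ List.Chain' I.t p ∧
  (∃ u ∈ K, ∃ x : I.α, p.head? = some x ∧ I.t u x) ∧
  ∀ x ∈ p, x ∉ DeltaF I F ∧ x ≠ a

/-- Membership predicate for the domain of the quasi-unravelling. -/
def QUOk (I : SInterp C) (F : Set I.α) (a : I.α) :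
    I.α ⊕ (Set I.α × List I.α) → Prop
  | Sum.inl u => u ∈ DeltaF I F ∪ {a}
  | Sum.inr (K, p) => (K = Ka I F a ∨ IsCriticalCluster I F K) ∧ IsQUPath I F a K p

/-- The domain of the quasi-unravelling of `(I, a)`. -/
def QUDom (I : SInterp C) (F : Set I.α) (a : I.α) : Type :=
  {z : I.α ⊕ (Set I.α × List I.α) // QUOk I F a z}

/-- The element of `I` that an element of the quasi-unravelling is a copy of. -/
def copyRaw {β : Type} (a : β) : β ⊕ (Set β × List β) → β
  | Sum.inl u => u
  | Sum.inr (_, p) => p.getLastD a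

/-- The generating edges of the quasi-unravelling (before transitive closure). -/
def QUBaseRaw (I : SInterp C) (F : Set I.α) :
    (I.α ⊕ (Set I.α × List I.α)) → (I.α ⊕ (Set I.α × List I.α)) → Prop
  | Sum.inl u, Sum.inl v => I.t u v ∧ v ∈ DeltaF I F
  | Sum.inl u, Sum.inr (K, _) => u ∈ K
  | Sum.inr (K, p), Sum.inr (K', p') => K = K' ∧ ∃ u : I.α, p' = p ++ [u]
  | Sum.inr (_, p), Sum.inl v =>
      ∃ u : I.α, p.getLast? = some u ∧ I.t u v ∧ v ∈ DeltaF I F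

/-- The quasi-unravelling of the rooted interpretation `(I, a)` with critical set `F`. -/
def quasiUnravel (I : SInterp C) (F : Set I.α) (a : I.α) : SInterp C where
  α := QUDom I F a
  A := fun c => {z | copyRaw a z.val ∈ I.A c}
  t := Relation.TransGen (fun z w => QUBaseRaw I F z.val w.val)

/-- The root of the quasi-unravelling. -/
def QUroot (I : SInterp C) (F : Set I.α) (a : I.α) : (quasiUnravel I F a).α :=
  ⟨Sum.inl a, Or.inr rfl⟩

/-- The transitive closure `I*` of `I`. -/
def transClose (I : SInterp C) : SInterp C where
  α := I.α
  A := I.A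
  t := Relation.TransGen I.t

end SInterp

namespace SInterp

variable {C : Type} {I : SInterp C} {F : Set I.α} {a : I.α}

theorem sameCluster.symm {u v : I.α} (h : sameCluster I u v) : sameCluster I v u :=
  h.imp Eq.symm And.symm

theorem sameCluster.trans {u v w : I.α} (huv : sameCluster I u v) (hvw : sameCluster I v w) :
    sameCluster I u w := by
  rcases huv with rfl | ⟨h₁, h₂⟩
  · exact hvw
  · rcases hvw with rfl | ⟨h₃, h₄⟩
    · exact Or.inr ⟨h₁, h₂⟩
    · exact Or.inr ⟨Relation.TransGen.trans h₁ h₃, Relation.TransGen.trans h₄ h₂⟩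

theorem sameCluster.reflTransGen {u v : I.α} (h : sameCluster I u v) :
    Relation.ReflTransGen I.t u v := by
  rcases h with rfl | ⟨h, -⟩
  · exact .refl
  · exact Relation.TransGen.to_reflTransGen h

/-- Elements of an index set of the quasi-unravelling lie in the same cluster. -/
theorem sameCluster_of_mem {K : Set I.α} (hK : K = Ka I F a ∨ IsCriticalCluster I F K)
    {u v : I.α} (hu : u ∈ K) (hv : v ∈ K) : sameCluster I u v := by
  rcases hK with rfl | ⟨⟨w, rfl⟩, -⟩
  · have key : ∀ x ∈ Ka I F a, sameCluster I a x := by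
      rintro x (rfl | ⟨h, -⟩)
      · exact Or.inl rfl
      · exact h
    exact (key u hu).symm.trans (key v hv)
  · exact sameCluster.symm hu |>.trans hv

theorem reflTransGen_getLastD {β : Type} {r : β → β → Prop} (b : β) {l : List β} {x : β}
    (hl : List.IsChain r l) (hx : l.head? = some x) :
    Relation.ReflTransGen r x (l.getLastD b) := by
  induction l generalizing x b with
  | nil => simp at hx
  | cons y l ih =>
    obtain rfl : y = x := by simpa using hx
    cases l with
    | nil => exact .refl
    | cons z l =>
      rw [List.isChain_cons_cons] at hl
      exact .head hl.1 (ih y hl.2 rfl)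

theorem transGen_copyRaw_of_base {z w : I.α ⊕ (Set I.α × List I.α)}
    (hz : QUOk I F a z) (hw : QUOk I F a w) (h : QUBaseRaw I F z w) :
    Relation.TransGen I.t (copyRaw a z) (copyRaw a w) := by
  rcases z with u | ⟨K, p⟩ <;> rcases w with v | ⟨K', p'⟩
  · exact .single h.1
  · obtain ⟨hK, -, hp, ⟨x, hx, y, hy, hxy⟩, -⟩ := hw
    exact (Relation.TransGen.tail' (sameCluster_of_mem hK h hx).reflTransGen
      hxy).trans_left (reflTransGen_getLastD a hp hy)
  · obtain ⟨u, hu, huv, -⟩ := h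
    exact .single (by simpa [copyRaw, List.getLastD_eq_getLast?, hu] using huv)
  · obtain ⟨-, u, rfl⟩ := h
    obtain ⟨-, hne, -⟩ := hz
    obtain ⟨-, -, hp, -⟩ := hw
    have hp := (List.isChain_append.1 hp).2.2 _ (List.getLast_mem_getLast? hne) u (by simp)
    refine .single ?_
    simpa [copyRaw, List.getLastD_eq_getLast?, List.getLast?_eq_getLast_of_ne_nil hne] using hp

/-- One step from the root or a critical cluster to an element outside gives a singleton path. -/
theorem exists_quOk_of_step {u v : I.α} (hu : u ∈ DeltaF I F ∪ {a}) (huv : I.t u v)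
    (hv : v ∉ DeltaF I F ∪ {a}) : ∃ K, QUOk I F a (Sum.inr (K, [v])) := by
  have path {K : Set I.α} (hK : u ∈ K) : IsQUPath I F a K [v] := by
    refine ⟨by simp, .singleton v, ⟨u, hK, v, rfl, huv⟩, ?_⟩
    intro x hx
    obtain rfl : x = v := by simpa using hx
    exact ⟨fun h => hv (Or.inl h), fun h => hv (Or.inr h)⟩
  rcases hu with ⟨f, hf, hc⟩ | rfl
  · exact ⟨cluster I u, Or.inr ⟨⟨u, rfl⟩, f, hf, hc⟩, path (Or.inl rfl)⟩
  · exact ⟨Ka I F u, Or.inl rfl, path (Or.inl rfl)⟩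

theorem exists_copy_of_reach {v : I.α} (h : Reach I a v) (hv : v ∉ DeltaF I F ∪ {a}) :
    ∃ K p, QUOk I F a (Sum.inr (K, p)) ∧ p.getLast? = some v := by
  induction h with
  | single h =>
    obtain ⟨K, hK⟩ := exists_quOk_of_step (Or.inr rfl) h hv
    exact ⟨K, _, hK, rfl⟩
  | @tail b v _ hbv ih =>
    by_cases hb : b ∈ DeltaF I F ∪ {a}
    · obtain ⟨K, hK⟩ := exists_quOk_of_step hb hbv hv
      exact ⟨K, _, hK, rfl⟩
    · obtain ⟨K, p, ⟨hK, hne, hp, ⟨u, hu, x, hx, hux⟩, hout⟩, hlast⟩ := ih hb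
      refine ⟨K, p ++ [v], ⟨hK, by simp, ?_, ⟨u, hu, x, by simp [hx], hux⟩, ?_⟩, by simp⟩
      · refine List.isChain_append.2 ⟨hp, .singleton v, ?_⟩
        simpa [hlast] using hbv
      · intro y hy
        rcases List.mem_append.1 hy with hy | hy
        · exact hout y hy
        · obtain rfl : y = v := by simpa using hy
          exact ⟨fun h => hv (Or.inl h), fun h => hv (Or.inr h)⟩

end SInterp

open SInterp in
/-- Quasi-unravelling homomorphism: the map sending each element of the
quasi-unravelling `Ĩ` of `(I, a)` to the element of `I` it is a copy of is a
homomorphism from `Ĩ` to the transitive closure `I*`, it maps the root to `a`,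
and it is surjective provided every element of `I` other than `a` is
`t`-reachable from `a`. -/
theorem quasi_unravel_hom {C : Type} (I : SInterp C) (F : Set I.α) (a : I.α) :
    IsHom (quasiUnravel I F a) (transClose I)
      (fun z : (quasiUnravel I F a).α => copyRaw a z.val) ∧
    copyRaw a (QUroot I F a).val = a ∧
    ((∀ v : I.α, v ≠ a → Reach I a v) →
      Function.Surjective
        (fun z : (quasiUnravel I F a).α => copyRaw a z.val)) := by
  refine ⟨⟨fun _ _ h => h, fun z w h => ?_⟩, rfl, fun hreach v => ?_⟩
  · exact Relation.TransGen.lift' (fun z : QUDom I F a => copyRaw a z.val)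
      (fun z w hzw => transGen_copyRaw_of_base z.property w.property hzw) z w h
  · by_cases hv : v ∈ DeltaF I F ∪ {a}
    · exact ⟨⟨Sum.inl v, hv⟩, rfl⟩
    · obtain ⟨K, p, hok, hlast⟩ := exists_copy_of_reach (hreach v fun h => hv (Or.inr h)) hv
      exact ⟨⟨Sum.inr (K, p), hok⟩, by simp [copyRaw, List.getLastD_eq_getLast?, hlast]⟩
end

section
/- Restrictions to coloured elements are inverse isomorphisms: Let (I,κ) be a k-sparse coloured interpretation, let x₁, x₂ be coloured elements with κ(x₁) = κ(x₂), and let F = {x | x is coloured}. Suppose h₁ is a colour-preserving homomorphism from I↾N_k^I(x₁) to I↾N_k^I(x₂) and h₂ is a colour-preserving homomorphism from I↾N_k^I(x₂) to I↾N_k^I(x₁) (with the induced colourings). Then h₁(x₁) = x₂ and h₂(x₂) = x₁; moreover h₂(h₁(y)) = y for every y ∈ F ∩ N_k^I(x₁) and h₁(h₂(z)) = z for every z ∈ F ∩ N_k^I(x₂), so that the restrictions of h₁ and h₂ to coloured elements are mutually inverse isomorphisms between the induced subinterpretations I↾(F ∩ N_k^I(x₁)) and I↾(F ∩ N_k^I(x₂)).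 -/
namespace Interp

/-- In a sparse interpretation, elements of a neighbourhood with the same colour coincide. -/
lemma Sparse.eq_of_colour_eq {Cn Rn Γ : Type} {I : Interp Cn Rn} {κ : I.α → Option Γ} {k : ℕ}
    (hs : Sparse I κ k) {x y y' : I.α} {γ : Γ} (hy : y ∈ Nbhd I k x) (hy' : y' ∈ Nbhd I k x)
    (hc : κ y = some γ) (hc' : κ y' = some γ) : y = y' := by
  by_contra hne
  exact hs x y y' hy hy' ⟨γ, hc⟩ ⟨γ, hc'⟩ hne (hc.trans hc'.symm)

end Interp

open Interp in
/-- Restrictions to coloured elements are inverse isomorphisms: in a `k`-sparse coloured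
interpretation, colour-preserving homomorphisms `h₁`, `h₂` between the `k`-neighbourhoods
of two equally-coloured elements `x₁`, `x₂` send `x₁` to `x₂` and `x₂` to `x₁`, and are
mutually inverse on coloured elements (so their restrictions to the coloured parts of the
neighbourhoods are mutually inverse isomorphisms of the induced subinterpretations). -/
theorem coloured_restriction_inverse_iso {Cn Rn Γ : Type} (k : ℕ)
    (I : Interp Cn Rn) (κ : I.α → Option Γ) (hsparse : Sparse I κ k)
    (x₁ x₂ : I.α) (γ : Γ) (hx₁ : κ x₁ = some γ) (hx₂ : κ x₂ = some γ)
    (h₁ : (I.restrict (Nbhd I k x₁)).α → (I.restrict (Nbhd I k x₂)).α)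
    (h₂ : (I.restrict (Nbhd I k x₂)).α → (I.restrict (Nbhd I k x₁)).α)
    (hh₁ : ColourHom (I.restrict (Nbhd I k x₁)) (I.restrict (Nbhd I k x₂))
      (fun a => κ a.val) (fun a => κ a.val) h₁)
    (hh₂ : ColourHom (I.restrict (Nbhd I k x₂)) (I.restrict (Nbhd I k x₁))
      (fun a => κ a.val) (fun a => κ a.val) h₂) :
    (h₁ ⟨x₁, mem_nbhd_self I k x₁⟩ : I.α) = x₂ ∧
    (h₂ ⟨x₂, mem_nbhd_self I k x₂⟩ : I.α) = x₁ ∧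
    (∀ y : (I.restrict (Nbhd I k x₁)).α, (∃ δ, κ y.val = some δ) → h₂ (h₁ y) = y) ∧
    (∀ z : (I.restrict (Nbhd I k x₂)).α, (∃ δ, κ z.val = some δ) → h₁ (h₂ z) = z) := by
  refine ⟨hsparse.eq_of_colour_eq (h₁ _).2 (mem_nbhd_self I k x₂) (hh₁.2.2 _ γ hx₁) hx₂,
    hsparse.eq_of_colour_eq (h₂ _).2 (mem_nbhd_self I k x₁) (hh₂.2.2 _ γ hx₂) hx₁, ?_, ?_⟩
  · rintro y ⟨δ, hδ⟩
    exact Subtype.ext (hsparse.eq_of_colour_eq (h₂ (h₁ y)).2 y.2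
      (hh₂.2.2 _ δ (hh₁.2.2 _ δ hδ)) hδ)
  · rintro z ⟨δ, hδ⟩
    exact Subtype.ext (hsparse.eq_of_colour_eq (h₁ (h₂ z)).2 z.2
      (hh₁.2.2 _ δ (hh₂.2.2 _ δ hδ)) hδ)
end

section
/- Short paths stay in neighbourhoods: Let I be an interpretation, x, z elements of I, and k : ℕ with d_I(x, z) ≤ k. Then the distance between x and z computed in the induced subinterpretation I↾N_k^I(x) equals d_I(x, z). -/
namespace Interp

variable {Cn Rn : Type}

/-- The `i`-th element of a walk is at distance at most `i` from its start. -/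
lemma dist_le_of_chain (I : Interp Cn Rn) {n : ℕ} (w : Fin (n + 1) → I.α)
    (hw : ∀ i : Fin n, Adj I (w i.castSucc) (w i.succ)) (i : Fin (n + 1)) :
    Interp.dist I (w 0) (w i) ≤ (i : ℕ) := by
  refine sInf_le ⟨(i : ℕ), ⟨fun j => w ⟨j, by omega⟩, rfl, rfl, fun j => ?_⟩, rfl⟩
  exact hw ⟨j, by omega⟩

/-- A finite distance is attained by a walk. -/
lemma exists_chainLen_of_dist_le (I : Interp Cn Rn) {x z : I.α} {k : ℕ}
    (hz : Interp.dist I x z ≤ (k : ℕ∞)) :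
    ∃ n ≤ k, ChainLen I n x z ∧ (n : ℕ∞) = Interp.dist I x z := by
  have hne : ((fun n : ℕ => (n : ℕ∞)) '' {n | ChainLen I n x z}).Nonempty := by
    by_contra h
    rw [Set.not_nonempty_iff_eq_empty] at h
    rw [Interp.dist, h, sInf_empty, top_le_iff] at hz
    exact ENat.natCast_ne_top k hz
  obtain ⟨n, hn, hd⟩ := csInf_mem hne
  have hd' : (n : ℕ∞) = Interp.dist I x z := hd
  exact ⟨n, by rw [← hd'] at hz; exact_mod_cast hz, hn, hd'⟩

/-- Distances in an induced subinterpretation are at least the original ones. -/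
lemma dist_le_dist_restrict (I : Interp Cn Rn) (Δ : Set I.α) (a b : Δ) :
    Interp.dist I a b ≤ Interp.dist (I.restrict Δ) a b := by
  refine le_sInf ?_
  rintro _ ⟨n, ⟨w, h0, hl, hw⟩, rfl⟩
  exact sInf_le ⟨n, ⟨fun i => (w i : I.α), congrArg Subtype.val h0,
    congrArg Subtype.val hl, hw⟩, rfl⟩

end Interp

open Interp in
/-- Short paths stay in neighbourhoods: if `d_I(x, z) ≤ k`, then the distance between
`x` and `z` computed in the induced subinterpretation `I ↾ N_k(x)` equals `d_I(x, z)`. -/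
theorem dist_restrict_nbhd {Cn Rn : Type} (I : Interp Cn Rn) (x z : I.α) (k : ℕ)
    (hz : dist I x z ≤ (k : ℕ∞)) :
    dist (I.restrict (Nbhd I k x)) ⟨x, mem_nbhd_self I k x⟩ ⟨z, hz⟩ = dist I x z := by
  refine le_antisymm ?_ (I.dist_le_dist_restrict _ _ _)
  obtain ⟨n, hnk, ⟨w, rfl, rfl, hw⟩, hd⟩ := I.exists_chainLen_of_dist_le hz
  rw [← hd]
  have hmem : ∀ i, w i ∈ Nbhd I k (w 0) := fun i =>
    (I.dist_le_of_chain w hw i).trans (by exact_mod_cast (by omega : (i : ℕ) ≤ k))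
  exact sInf_le ⟨n, ⟨fun i => ⟨w i, hmem i⟩, rfl, rfl, hw⟩, rfl⟩
end

section
/- Removing a dispensable element preserves reachable concepts: Let I be a single-role interpretation over C with t_I transitive. Suppose u ∈ α_I is such that for every concept name c with u ∈ A_I c there exists b ≠ u with t_I u b and b ∈ A_I c. Then for every v ∈ α_I with v ≠ u, rch_{I↾(α_I \ {u})}(v) = rch_I(v), where I↾(α_I \ {u}) is the induced subinterpretation obtained by removing u. -/
open SInterp in
/-- Removing a dispensable element preserves reachable concepts: if every concept of
`u` is witnessed by a `t`-successor distinct from `u`, then for every `v ≠ u` the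
reachable concept names of `v` in `I` with `u` removed equal those in `I`. -/
theorem remove_dispensable_preserves_rch {C : Type} (I : SInterp C)
    (htrans : Transitive I.t) (u : I.α)
    (hdisp : ∀ c : C, u ∈ I.A c → ∃ b : I.α, b ≠ u ∧ I.t u b ∧ b ∈ I.A c)
    (v : I.α) (hv : v ≠ u) :
    rch (I.restrict {x | x ≠ u}) ⟨v, hv⟩ = rch I v := by
  ext c
  constructor
  · rintro ⟨b, hvb, hbc⟩
    exact ⟨b, hvb.lift Subtype.val fun _ _ h => h, hbc⟩
  · rintro ⟨b, hvb, hbc⟩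
    have hvb' : I.t v b := hvb.trans_induction_on (fun h => h) fun _ _ h h' => htrans h h'
    by_cases hbu : b = u
    · subst hbu
      obtain ⟨d, hdu, hbd, hdc⟩ := hdisp c hbc
      exact ⟨⟨d, hdu⟩, .single (htrans hvb' hbd), hdc⟩
    · exact ⟨⟨b, hbu⟩, .single hvb', hbc⟩
end

section
/- Indispensable elements form short simple paths: Let I be a single-role interpretation over a finite type C of concept names with ℓ = card C, and suppose t_I is transitive. Call an element u dispensable if for every concept name c with u ∈ A_I c there exists b ≠ u with t_I u b and b ∈ A_I c; otherwise u is indispensable. Then every finite sequence u_1, …, u_m of pairwise distinct indispensable elements with t_I u_i u_{i+1} for all i < m satisfies m ≤ ℓ. -/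
open SInterp in
/-- Indispensable elements form short simple paths: in a transitive single-role
interpretation over a finite type `C` of concept names, every simple forward `t`-path
through indispensable elements has length at most `card C`. -/
theorem indispensable_path_short {C : Type} [Fintype C] (I : SInterp C)
    (htrans : Transitive I.t)
    (L : List I.α) (hnodup : L.Nodup)
    (hind : ∀ u ∈ L,
      ¬ (∀ c : C, u ∈ I.A c → ∃ b : I.α, b ≠ u ∧ I.t u b ∧ b ∈ I.A c))
    (hchain : L.Chain' I.t) :
    L.length ≤ Fintype.card C := by
  classical
  have hwit : ∀ u : L.toFinset, ∃ c : C, (u : I.α) ∈ I.A c ∧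
      ∀ b, I.t u b → b ∈ I.A c → b = u := by
    intro u
    have h := hind u (List.mem_toFinset.mp u.2)
    push Not at h
    obtain ⟨c, huc, hc⟩ := h
    exact ⟨c, huc, fun b htb hbc => by_contra fun hne => hc b hne htb hbc⟩
  choose f hfmem hfuniq using hwit
  have : IsTrans I.α I.t := ⟨fun _ _ _ => @htrans _ _ _⟩
  have hpair : L.Pairwise I.t := hchain.pairwise
  have hinj : Function.Injective f := by
    intro u v huv
    by_contra hne
    have hcomp : I.t u v ∨ I.t v u :=
      have : Std.Symm fun a b => I.t a b ∨ I.t b a := ⟨fun _ _ => Or.symm⟩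
      (hpair.imp (S := fun a b => I.t a b ∨ I.t b a) Or.inl).forall
        (List.mem_toFinset.mp u.2) (List.mem_toFinset.mp v.2) (fun h => hne (Subtype.ext h))
    rcases hcomp with h | h
    · exact hne (Subtype.ext (hfuniq u v h (huv ▸ hfmem v)).symm)
    · exact hne (Subtype.ext (hfuniq v u h (huv ▸ hfmem u)))
  have hcard := Fintype.card_le_of_injective f hinj
  rwa [Fintype.card_coe, List.toFinset_card_of_nodup hnodup] at hcard
end
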